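/- Lemma 3.8, part 2 (concentration of the left-projected truncated initialization, fixed threshold). There exists a universal constant c > 0 such that the following holds. Assume Assumption 1 and let the a_ki and y_ki be as in the context, with C̃ := 9κ²μ². Fix ε₁ ∈ (0,1) and a deterministic threshold α with C̃(1 − ε₁)‖X*‖_F²/q ≤ α ≤ C̃(1 + ε₁)‖X*‖_F²/q. Let X̂₀(α) := (1/m)·Σ_{k,i} a_ki·y_ki·1{y_ki² ≤ α}·e_kᵀ and let D(α) be the q×q diagonal matrix with entries β_k(α) := E[ζ²·1{‖x*_k‖²ζ² ≤ α}] (ζ standard Gaussian). Then with probability at least 1 − exp(qr − c·ε₁²·mq/(μ²κ²)), ‖(X̂₀(α) − X*·D(α))ᵀ·U*‖_F ≤ 1.1·ε₁·‖X*‖_F. -/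

import Mathlib

open MeasureTheory ProbabilityTheory Matrix
open scoped ENNReal

noncomputable section

/-- Euclidean norm of a finitely-indexed real vector. -/
def vnorm {ι : Type*} [Fintype ι] (v : ι → ℝ) : ℝ := Real.sqrt (∑ i, v i ^ 2)

/-- Frobenius norm of a real matrix. -/
def frob {ι ι' : Type*} [Fintype ι] [Fintype ι'] (M : Matrix ι ι' ℝ) : ℝ :=
  Real.sqrt (∑ i, ∑ j, M i j ^ 2)

/-- Spectral (ℓ2 operator) norm of a real matrix. -/
def spec {ι ι' : Type*} [Fintype ι] [Fintype ι'] (M : Matrix ι ι' ℝ) : ℝ :=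
  sSup {c | ∃ z, vnorm z = 1 ∧ c = vnorm (M.mulVec z)}

/-- Smallest singular value of an r×q matrix with r ≤ q (or of a square matrix):
the minimum of ‖Bᵀw‖ over unit vectors w. -/
def sigMin {ι ι' : Type*} [Fintype ι] [Fintype ι'] (B : Matrix ι ι' ℝ) : ℝ :=
  sInf {c | ∃ w, vnorm w = 1 ∧ c = vnorm (Bᵀ.mulVec w)}

/-- The k-th column of a matrix. -/
def matCol {ι ι' : Type*} (B : Matrix ι ι' ℝ) (k : ι') : ι → ℝ := fun i => B i k

/-- Subspace distance SD(U₁,U₂) := ‖(I − U₁U₁ᵀ)U₂‖_F. -/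
def SD {n r : ℕ} (U₁ U₂ : Matrix (Fin n) (Fin r) ℝ) : ℝ :=
  frob ((1 - U₁ * U₁ᵀ) * U₂)

/-- The standard Gaussian measure on ℝ. -/
def stdGaussian : Measure ℝ := gaussianReal 0 1

instance : IsProbabilityMeasure stdGaussian :=
  inferInstanceAs (IsProbabilityMeasure (gaussianReal 0 1))

/-- A standard Gaussian random vector in ℝⁿ (i.i.d. N(0,1) coordinates). -/
def gaussianVec (n : ℕ) : Measure (Fin n → ℝ) := Measure.pi fun _ => stdGaussian

instance (n : ℕ) : IsProbabilityMeasure (gaussianVec n) := by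
  unfold gaussianVec; infer_instance

/-- i.i.d. standard Gaussian random vectors a_{k i} ∈ ℝⁿ, k ∈ [q], i ∈ [m]. -/
def gaussianMatrices (q m n : ℕ) : Measure (Fin q → Fin m → Fin n → ℝ) :=
  Measure.pi fun _ => Measure.pi fun _ => gaussianVec n

instance (q m n : ℕ) : IsProbabilityMeasure (gaussianMatrices q m n) := by
  unfold gaussianMatrices; infer_instance

/-- Truncated spectral-initialization matrix X̂₀ = (1/m) Σ_{k,i} a_ki y_ki 1{y_ki² ≤ α} e_kᵀ. -/
def initMat {n q m : ℕ} (xstar : Fin q → Fin n → ℝ) (α : ℝ)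
    (ω : Fin q → Fin m → Fin n → ℝ) : Matrix (Fin n) (Fin q) ℝ :=
  Matrix.of fun j k => (1 / (m : ℝ)) * ∑ i, ω k i j * (ω k i ⬝ᵥ xstar k) *
    (if (ω k i ⬝ᵥ xstar k) ^ 2 ≤ α then 1 else 0)

/-- Data-dependent truncation threshold α := C̃ Σ_{k,i} y_ki² / (mq). -/
def initAlpha {n q m : ℕ} (xstar : Fin q → Fin n → ℝ) (Ctil : ℝ)
    (ω : Fin q → Fin m → Fin n → ℝ) : ℝ :=
  Ctil * ((∑ k, ∑ i, (ω k i ⬝ᵥ xstar k) ^ 2) / ((m : ℝ) * q))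

/-- β(α) := E[ζ² 1{‖x‖² ζ² ≤ α}] for ζ standard Gaussian. -/
def betaK (normx α : ℝ) : ℝ :=
  ∫ z, z ^ 2 * (if normx ^ 2 * z ^ 2 ≤ α then 1 else 0) ∂stdGaussian

/-- The least-squares estimate b̂ := (UᵀAᵀAU)⁻¹ Uᵀ Aᵀ A x. -/
def lsEst {n r m : ℕ} (U : Matrix (Fin n) (Fin r) ℝ) (A : Matrix (Fin m) (Fin n) ℝ)
    (x : Fin n → ℝ) : Fin r → ℝ :=
  ((Uᵀ * Aᵀ * A * U)⁻¹ * Uᵀ * Aᵀ * A).mulVec x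

/-- Gradient w.r.t. U of the squared loss: Σ_k Aᵀ(AUb̂_k − Ax*_k)b̂_kᵀ. -/
def gradU {n r q m : ℕ} (U : Matrix (Fin n) (Fin r) ℝ)
    (A : Fin q → Matrix (Fin m) (Fin n) ℝ) (xstar : Fin q → Fin n → ℝ)
    (bhat : Fin q → Fin r → ℝ) : Matrix (Fin n) (Fin r) ℝ :=
  ∑ k, (A k)ᵀ * vecMulVec ((A k).mulVec (U.mulVec (bhat k) - xstar k)) (bhat k)

/-- `U` has orthonormal columns whose span is the span of eigenvectors of `S`
corresponding to its `r` largest eigenvalues: `S` maps the column span of `U` into itself,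
and wᵀSw ≥ zᵀSz for unit w in the span and unit z orthogonal to it. -/
def IsTopREigenBasis {n r : ℕ} (S : Matrix (Fin n) (Fin n) ℝ)
    (U : Matrix (Fin n) (Fin r) ℝ) : Prop :=
  Uᵀ * U = 1 ∧ (∃ M : Matrix (Fin r) (Fin r) ℝ, S * U = U * M) ∧
  ∀ w z : Fin n → ℝ, (∃ cvec : Fin r → ℝ, w = U.mulVec cvec) → Uᵀ.mulVec z = 0 →
    vnorm w = 1 → vnorm z = 1 → z ⬝ᵥ S.mulVec z ≤ w ⬝ᵥ S.mulVec w

/-- Sample sizes for the 2T+1 sample splits: batch τ ∈ {0,…,T} has m τ rows,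
batch τ = T + t (t ∈ {1,…,T}) has m t rows. -/
def msize (m : ℕ → ℕ) (T τ : ℕ) : ℕ := if τ ≤ T then m τ else m (τ - T)

/-- The joint distribution of all 2T+1 independent sample batches of i.i.d. standard
Gaussian measurement vectors. -/
def splitGauss (m : ℕ → ℕ) (T q n : ℕ) :
    Measure (∀ τ : Fin (2 * T + 1), Fin q → Fin (msize m T τ.1) → Fin n → ℝ) :=
  Measure.pi fun τ => gaussianMatrices q (msize m T τ.1) n

instance (m : ℕ → ℕ) (T q n : ℕ) : IsProbabilityMeasure (splitGauss m T q n) := by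
  unfold splitGauss; infer_instance

end

lemma map_eval_gaussianVec {n : ℕ} (i : Fin n) :
    (gaussianVec n).map (fun a => a i) = gaussianReal 0 1 :=
  (measurePreserving_eval (fun _ : Fin n => _root_.stdGaussian) i).map_eq

lemma hasGaussianLaw_gaussianVec (n : ℕ) :
    HasGaussianLaw (fun a : Fin n → ℝ => a) (gaussianVec n) := by
  refine iIndepFun.hasGaussianLaw (X := fun i (a : Fin n → ℝ) => a i) (fun i => ?_) ?_
  · refine ⟨?_⟩
    rw [map_eval_gaussianVec]; infer_instance
  · exact iIndepFun_pi (X := fun (_ : Fin n) (z : ℝ) => z) (fun _ => by fun_prop)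

/-- The continuous linear functional `a ↦ a ⬝ᵥ v`. -/
noncomputable def dotCLM {n : ℕ} (v : Fin n → ℝ) : (Fin n → ℝ) →L[ℝ] ℝ :=
  ∑ i, v i • ContinuousLinearMap.proj i

lemma dotCLM_apply {n : ℕ} (v a : Fin n → ℝ) : dotCLM v a = a ⬝ᵥ v := by
  simp [dotCLM, dotProduct, mul_comm]

lemma measurable_dotProduct_right {n : ℕ} (v : Fin n → ℝ) :
    Measurable fun a : Fin n → ℝ => a ⬝ᵥ v := by
  unfold dotProduct; fun_prop

lemma hasGaussianLaw_dotProduct {n : ℕ} (v : Fin n → ℝ) :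
    HasGaussianLaw (fun a : Fin n → ℝ => a ⬝ᵥ v) (gaussianVec n) := by
  simpa [dotCLM_apply] using (hasGaussianLaw_gaussianVec n).map_fun (dotCLM v)

lemma hasGaussianLaw_dotProduct_prod {n : ℕ} (u v : Fin n → ℝ) :
    HasGaussianLaw (fun a : Fin n → ℝ => (a ⬝ᵥ u, a ⬝ᵥ v)) (gaussianVec n) := by
  simpa [dotCLM_apply] using (hasGaussianLaw_gaussianVec n).map_fun ((dotCLM u).prod (dotCLM v))

lemma integral_eval_gaussianVec {n : ℕ} (i : Fin n) : ∫ a, a i ∂gaussianVec n = 0 := by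
  have h := integral_map (μ := gaussianVec n) (φ := fun a => a i) (f := fun z : ℝ => z)
    (measurable_pi_apply i).aemeasurable (by fun_prop)
  rw [← h, map_eval_gaussianVec, integral_id_gaussianReal]

lemma memLp_eval_gaussianVec {n : ℕ} (i : Fin n) :
    MemLp (fun a : Fin n → ℝ => a i) 2 (gaussianVec n) :=
  ((hasGaussianLaw_gaussianVec n).eval i).memLp_two

lemma covariance_eval_gaussianVec {n : ℕ} (i j : Fin n) :
    cov[fun a => a i, fun a => a j; gaussianVec n] = if i = j then 1 else 0 := by
  split_ifs with h
  · subst h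
    rw [covariance_self (measurable_pi_apply i).aemeasurable]
    have h := variance_map (X := fun z : ℝ => z) (Y := fun a : Fin n → ℝ => a i)
      (μ := gaussianVec n) (by fun_prop) (measurable_pi_apply i).aemeasurable
    rw [map_eval_gaussianVec, variance_fun_id_gaussianReal] at h
    simpa [Function.comp_def] using h.symm
  · exact IndepFun.covariance_eq_zero
      ((iIndepFun_pi (μ := fun _ : Fin n => _root_.stdGaussian)
        (X := fun (_ : Fin n) (z : ℝ) => z) (fun _ => by fun_prop)).indepFun h)
      (memLp_eval_gaussianVec i) (memLp_eval_gaussianVec j)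

lemma covariance_dotProduct {n : ℕ} (u v : Fin n → ℝ) :
    cov[fun a => a ⬝ᵥ u, fun a => a ⬝ᵥ v; gaussianVec n] = u ⬝ᵥ v := by
  unfold dotProduct
  rw [covariance_fun_sum_fun_sum (X := fun i (a : Fin n → ℝ) => a i * u i)
    (Y := fun i (a : Fin n → ℝ) => a i * v i)
    (fun i => (memLp_eval_gaussianVec i).mul_const _)
    (fun i => (memLp_eval_gaussianVec i).mul_const _)]
  simp [covariance_mul_const_left, covariance_mul_const_right, covariance_eval_gaussianVec]

lemma integral_dotProduct_gaussianVec {n : ℕ} (v : Fin n → ℝ) :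
    ∫ a, a ⬝ᵥ v ∂gaussianVec n = 0 := by
  unfold dotProduct
  rw [integral_finsetSum _ fun i _ =>
    ((memLp_eval_gaussianVec i).integrable (by norm_num)).mul_const _]
  simp [integral_mul_const, integral_eval_gaussianVec]

lemma map_dotProduct_gaussianVec {n : ℕ} (v : Fin n → ℝ) :
    (gaussianVec n).map (fun a => a ⬝ᵥ v) = gaussianReal 0 (v ⬝ᵥ v).toNNReal := by
  rw [(hasGaussianLaw_dotProduct v).map_eq_gaussianReal, integral_dotProduct_gaussianVec,
    ← covariance_self (measurable_dotProduct_right v).aemeasurable, covariance_dotProduct]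

lemma dotProduct_self_nonneg_real {n : ℕ} (v : Fin n → ℝ) : 0 ≤ v ⬝ᵥ v :=
  Finset.sum_nonneg fun _ _ => mul_self_nonneg _

lemma vnorm_sq {n : ℕ} (v : Fin n → ℝ) : vnorm v ^ 2 = v ⬝ᵥ v := by
  rw [vnorm, Real.sq_sqrt (Finset.sum_nonneg fun _ _ => sq_nonneg _)]
  simp [dotProduct, sq]

lemma mgf_dotProduct_gaussianVec {n : ℕ} (v : Fin n → ℝ) :
    ∫ a, Real.exp (a ⬝ᵥ v) ∂gaussianVec n = Real.exp (v ⬝ᵥ v / 2) := by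
  have h := mgf_gaussianReal (map_dotProduct_gaussianVec v) 1
  simpa [mgf, Real.coe_toNNReal _ (dotProduct_self_nonneg_real v)] using h

lemma integrable_exp_dotProduct {n : ℕ} (v : Fin n → ℝ) :
    Integrable (fun a => Real.exp (a ⬝ᵥ v)) (gaussianVec n) := by
  by_contra h
  have := mgf_dotProduct_gaussianVec v
  rw [integral_undef h] at this
  exact absurd this (Real.exp_pos _).ne

/-- The scalar truncation `t ↦ t 1{t² ≤ α}`. -/
noncomputable def trunc (α t : ℝ) : ℝ := t * (if t ^ 2 ≤ α then 1 else 0)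

lemma measurable_trunc (α : ℝ) : Measurable (trunc α) := by
  unfold trunc
  refine measurable_id.mul (Measurable.ite ?_ measurable_const measurable_const)
  exact measurableSet_le (by fun_prop) measurable_const

lemma abs_trunc_le {α : ℝ} (t : ℝ) : |trunc α t| ≤ √α := by
  unfold trunc
  split_ifs with h
  · simpa using Real.abs_le_sqrt h
  · simp

lemma betaK_eq_integral_dotProduct {n : ℕ} (x : Fin n → ℝ) (α : ℝ) :
    ∫ a, (a ⬝ᵥ x) * trunc α (a ⬝ᵥ x) ∂gaussianVec n = vnorm x ^ 2 * betaK (vnorm x) α := by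
  have hm : (gaussianVec n).map (fun a => a ⬝ᵥ x)
      = (_root_.stdGaussian).map (fun z => vnorm x * z) := by
    rw [map_dotProduct_gaussianVec, _root_.stdGaussian, gaussianReal_map_const_mul]
    congr 1
    · simp
    · ext; simp [vnorm_sq, dotProduct_self_nonneg_real]
  have hf : Measurable fun z => z * trunc α z := measurable_id.mul (measurable_trunc α)
  rw [← integral_map (φ := fun a => a ⬝ᵥ x) (f := fun z => z * trunc α z)
    (measurable_dotProduct_right x).aemeasurable hf.aestronglyMeasurable, hm,
    integral_map (by fun_prop) hf.aestronglyMeasurable, betaK, ← integral_const_mul]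
  refine integral_congr_ae (ae_of_all _ fun z => ?_)
  simp only [trunc, mul_pow]; ring

lemma integral_dotProduct_mul_trunc {n : ℕ} (v x : Fin n → ℝ) (α : ℝ) :
    ∫ a, (a ⬝ᵥ v) * trunc α (a ⬝ᵥ x) ∂gaussianVec n = betaK (vnorm x) α * (x ⬝ᵥ v) := by
  by_cases hx : x = 0
  · simp [hx, trunc]
  have hxx : x ⬝ᵥ x ≠ 0 := by simpa [dotProduct_self_eq_zero] using hx
  set s : ℝ := (x ⬝ᵥ v) / (x ⬝ᵥ x) with hs
  have hint : ∀ w : Fin n → ℝ,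
      Integrable (fun a => (a ⬝ᵥ w) * trunc α (a ⬝ᵥ x)) (gaussianVec n) := fun w =>
    (hasGaussianLaw_dotProduct w).integrable.mul_bdd (c := √α)
      ((measurable_trunc α).comp (measurable_dotProduct_right x)).aestronglyMeasurable
      (ae_of_all _ fun a => abs_trunc_le _)
  have hind : IndepFun (fun a => a ⬝ᵥ (v - s • x)) (fun a => a ⬝ᵥ x) (gaussianVec n) := by
    refine (hasGaussianLaw_dotProduct_prod _ _).indepFun_of_covariance_eq_zero ?_
    rw [covariance_dotProduct, sub_dotProduct, smul_dotProduct, hs, smul_eq_mul,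
      div_mul_cancel₀ _ hxx, dotProduct_comm, sub_self]
  have h0 : ∫ a, (a ⬝ᵥ (v - s • x)) * trunc α (a ⬝ᵥ x) ∂gaussianVec n = 0 := by
    have := (hind.comp measurable_id (measurable_trunc α)).integral_fun_mul_eq_mul_integral
      (measurable_dotProduct_right _).aestronglyMeasurable
      ((measurable_trunc α).comp (measurable_dotProduct_right x)).aestronglyMeasurable
    simpa only [Function.comp_def, id, integral_dotProduct_gaussianVec, zero_mul] using this
  have hsplit : ∀ a : Fin n → ℝ, (a ⬝ᵥ v) * trunc α (a ⬝ᵥ x)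
      = (a ⬝ᵥ (v - s • x)) * trunc α (a ⬝ᵥ x) + s * ((a ⬝ᵥ x) * trunc α (a ⬝ᵥ x)) := fun a => by
    rw [dotProduct_sub, dotProduct_smul, smul_eq_mul]; ring
  simp_rw [hsplit]
  rw [integral_add (hint _) ((hint x).const_mul s), h0, integral_const_mul,
    betaK_eq_integral_dotProduct, vnorm_sq, hs]
  field_simp
  ring

/-- If `|Y| ≤ |a ⬝ᵥ v|` for a standard Gaussian vector `a`, then the centred variable `Y - E Y`
is sub-Gaussian. -/
lemma lintegral_exp_centered_le {n : ℕ} (v : Fin n → ℝ) {Y : (Fin n → ℝ) → ℝ}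
    (hY : Measurable Y) (hle : ∀ a, |Y a| ≤ |a ⬝ᵥ v|) :
    ∫⁻ a, ENNReal.ofReal (Real.exp (Y a - ∫ b, Y b ∂gaussianVec n)) ∂gaussianVec n
      ≤ ENNReal.ofReal (Real.exp (v ⬝ᵥ v)) := by
  have hneg : ∀ a : Fin n → ℝ, -(a ⬝ᵥ v) = a ⬝ᵥ (-v) := fun a => by simp
  have hcosh : Integrable (fun a => Real.cosh (a ⬝ᵥ v)) (gaussianVec n) := by
    simp_rw [Real.cosh_eq, hneg]
    exact ((integrable_exp_dotProduct v).add (integrable_exp_dotProduct (-v))).div_const 2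
  have hcoshI : ∫ a, Real.cosh (a ⬝ᵥ v) ∂gaussianVec n = Real.exp (v ⬝ᵥ v / 2) := by
    simp_rw [Real.cosh_eq, hneg]
    rw [integral_div, integral_add (integrable_exp_dotProduct v) (integrable_exp_dotProduct (-v)),
      mgf_dotProduct_gaussianVec, mgf_dotProduct_gaussianVec]
    simp
  have hcY : ∀ a, Real.cosh (Y a) ≤ Real.cosh (a ⬝ᵥ v) := fun a => Real.cosh_le_cosh.2 (hle a)
  have hexp : ∀ t : ℝ, Real.exp t ≤ 2 * Real.cosh t := fun t => by
    rw [Real.cosh_eq]; linarith [Real.exp_pos (-t)]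
  have hiP : Integrable (fun a => Real.exp (Y a)) (gaussianVec n) := by
    refine (hcosh.const_mul 2).mono' (by fun_prop) (ae_of_all _ fun a => ?_)
    rw [Real.norm_eq_abs, Real.abs_exp]
    linarith [hexp (Y a), hcY a]
  have hiN : Integrable (fun a => Real.exp (-Y a)) (gaussianVec n) := by
    refine (hcosh.const_mul 2).mono' (by fun_prop) (ae_of_all _ fun a => ?_)
    rw [Real.norm_eq_abs, Real.abs_exp]
    have := hexp (-Y a)
    rw [Real.cosh_neg] at this
    linarith [hcY a]
  have hYi : Integrable Y (gaussianVec n) :=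
    (hasGaussianLaw_dotProduct v).integrable.mono hY.aestronglyMeasurable
      (ae_of_all _ fun a => hle a)
  have hjensen : Real.exp (-∫ b, Y b ∂gaussianVec n) ≤ ∫ a, Real.exp (-Y a) ∂gaussianVec n := by
    have := convexOn_exp.map_integral_le (μ := gaussianVec n) (f := fun a => -Y a)
      Real.continuous_exp.continuousOn isClosed_univ (by simp) hYi.neg hiN
    simpa [integral_neg] using this
  have hsum : (∫ a, Real.exp (Y a) ∂gaussianVec n) + ∫ a, Real.exp (-Y a) ∂gaussianVec n
      ≤ 2 * Real.exp (v ⬝ᵥ v / 2) := by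
    rw [← integral_add hiP hiN, ← hcoshI, ← integral_const_mul]
    refine integral_mono (hiP.add hiN) (hcosh.const_mul 2) fun a => ?_
    have := hcY a
    rw [Real.cosh_eq] at this
    simp only
    linarith
  have hP0 : 0 ≤ ∫ a, Real.exp (Y a) ∂gaussianVec n := integral_nonneg fun a => (Real.exp_pos _).le
  simp_rw [sub_eq_add_neg, Real.exp_add]
  rw [← ofReal_integral_eq_lintegral_ofReal (hiP.mul_const _) (ae_of_all _ fun a => by positivity),
    integral_mul_const]
  refine ENNReal.ofReal_le_ofReal ((mul_le_mul_of_nonneg_left hjensen hP0).trans ?_)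
  have hE : Real.exp (v ⬝ᵥ v) = Real.exp (v ⬝ᵥ v / 2) ^ 2 := by
    rw [← Real.exp_nat_mul]; congr 1; push_cast; ring
  rw [hE]
  have hN0 : 0 ≤ ∫ a, Real.exp (-Y a) ∂gaussianVec n :=
    integral_nonneg fun a => (Real.exp_pos _).le
  nlinarith [sq_nonneg ((∫ a, Real.exp (Y a) ∂gaussianVec n) - ∫ a, Real.exp (-Y a) ∂gaussianVec n)]

lemma lintegral_exp_trunc_le {n : ℕ} (v x : Fin n → ℝ) {α : ℝ} (hα : 0 ≤ α) :
    ∫⁻ a, ENNReal.ofReal (Real.exp ((a ⬝ᵥ v) * trunc α (a ⬝ᵥ x)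
        - betaK (vnorm x) α * (x ⬝ᵥ v))) ∂gaussianVec n
      ≤ ENNReal.ofReal (Real.exp (α * (v ⬝ᵥ v))) := by
  have h := lintegral_exp_centered_le (√α • v) (Y := fun a => (a ⬝ᵥ v) * trunc α (a ⬝ᵥ x))
    ((measurable_dotProduct_right v).mul ((measurable_trunc α).comp (measurable_dotProduct_right x)))
    (fun a => by
      rw [dotProduct_smul, smul_eq_mul, abs_mul, abs_mul, abs_of_nonneg (Real.sqrt_nonneg α),
        mul_comm]
      exact mul_le_mul_of_nonneg_right (abs_trunc_le _) (abs_nonneg _))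
  simp only [integral_dotProduct_mul_trunc, smul_dotProduct, dotProduct_smul, smul_eq_mul,
    ← mul_assoc, Real.mul_self_sqrt hα] at h
  simpa only [← mul_assoc] using h

lemma lintegral_prod_pi {ι : Type*} [Fintype ι] {Ω : ι → Type*} [∀ i, MeasurableSpace (Ω i)]
    (P : ∀ i, Measure (Ω i)) [∀ i, IsProbabilityMeasure (P i)] (f : ∀ i, Ω i → ℝ≥0∞)
    (hf : ∀ i, Measurable (f i)) :
    ∫⁻ ω, ∏ i, f i (ω i) ∂Measure.pi P = ∏ i, ∫⁻ z, f i z ∂P i := by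
  refine (lintegral_prod_eq_prod_lintegral_of_indepFun Finset.univ
    (fun i (ω : ∀ i, Ω i) => f i (ω i))
    (iIndepFun_pi fun i => (hf i).aemeasurable)
    fun i => (hf i).comp (measurable_pi_apply i)).trans ?_
  exact Finset.prod_congr rfl fun i _ =>
    (measurePreserving_eval P i).lintegral_comp (hf i)

lemma lintegral_exp_dotProduct {r : ℕ} (u : Fin r → ℝ) :
    ∫⁻ h, ENNReal.ofReal (Real.exp (h ⬝ᵥ u)) ∂gaussianVec r
      = ENNReal.ofReal (Real.exp (u ⬝ᵥ u / 2)) := by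
  rw [← mgf_dotProduct_gaussianVec, ofReal_integral_eq_lintegral_ofReal
    (integrable_exp_dotProduct u) (ae_of_all _ fun a => (Real.exp_pos _).le)]

lemma lintegral_exp_sq_div_four :
    ∫⁻ z, ENNReal.ofReal (Real.exp (z ^ 2 / 4)) ∂_root_.stdGaussian = ENNReal.ofReal (√2) := by
  have hpt : ∀ z : ℝ, gaussianPDFReal 0 1 z * Real.exp (z ^ 2 / 4)
      = (√(2 * Real.pi))⁻¹ * Real.exp (-(1 / 4) * z ^ 2) := fun z => by
    simp only [gaussianPDFReal, NNReal.coe_one, mul_one, sub_zero, mul_assoc, ← Real.exp_add]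
    ring_nf
  have hconv : ∫⁻ z, ENNReal.ofReal (Real.exp (z ^ 2 / 4)) ∂_root_.stdGaussian
      = ∫⁻ z, ENNReal.ofReal ((√(2 * Real.pi))⁻¹ * Real.exp (-(1 / 4) * z ^ 2)) := by
    rw [_root_.stdGaussian, gaussianReal_of_var_ne_zero _ one_ne_zero,
      lintegral_withDensity_eq_lintegral_mul _ (measurable_gaussianPDF 0 1) (by fun_prop)]
    refine lintegral_congr fun z => ?_
    rw [Pi.mul_apply, gaussianPDF, ← ENNReal.ofReal_mul (gaussianPDFReal_nonneg _ _ _), hpt]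
  rw [hconv, ← ofReal_integral_eq_lintegral_ofReal
    ((integrable_exp_neg_mul_sq (by norm_num)).const_mul _) (ae_of_all _ fun z => by positivity),
    integral_const_mul, integral_gaussian, ← Real.sqrt_inv, ← Real.sqrt_mul (by positivity)]
  congr 2
  field_simp
  norm_num

lemma lintegral_exp_dotProduct_self_div_four (r : ℕ) :
    ∫⁻ h, ENNReal.ofReal (Real.exp (h ⬝ᵥ h / 4)) ∂gaussianVec r = ENNReal.ofReal (√2) ^ r := by
  have h := lintegral_prod_pi (fun _ : Fin r => _root_.stdGaussian)
    (fun _ z => ENNReal.ofReal (Real.exp (z ^ 2 / 4))) (fun _ => by fun_prop)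
  simp only [lintegral_exp_sq_div_four, Finset.prod_const, Finset.card_univ, Fintype.card_fin] at h
  rw [← h, gaussianVec]
  refine lintegral_congr fun z => ?_
  rw [← ENNReal.ofReal_prod_of_nonneg fun _ _ => (Real.exp_pos _).le, ← Real.exp_sum]
  simp only [dotProduct, Finset.sum_div, sq]

/-- The deviation, in direction `v`, of one column of the truncated initialization. -/
noncomputable def colDev {n m : ℕ} (x : Fin n → ℝ) (α : ℝ) (A : Fin m → Fin n → ℝ)
    (v : Fin n → ℝ) : ℝ :=
  (1 / (m : ℝ)) * ∑ i, (A i ⬝ᵥ v) * trunc α (A i ⬝ᵥ x) - betaK (vnorm x) α * (x ⬝ᵥ v)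

lemma measurable_trunc_dotProduct {n m : ℕ} (x : Fin n → ℝ) (α : ℝ) (i : Fin m) :
    Measurable fun A : Fin m → Fin n → ℝ => trunc α (A i ⬝ᵥ x) :=
  (measurable_trunc α).comp ((measurable_dotProduct_right x).comp (measurable_pi_apply i))

lemma measurable_colDev {n m : ℕ} (x : Fin n → ℝ) (α : ℝ) (v : Fin n → ℝ) :
    Measurable fun A : Fin m → Fin n → ℝ => colDev x α A v := by
  unfold colDev
  refine Measurable.sub_const (measurable_const.mul
    (Finset.measurable_fun_sum _ fun i _ => ?_)) _
  exact ((measurable_dotProduct_right v).comp (measurable_pi_apply i)).mul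
    (measurable_trunc_dotProduct x α i)

lemma colDev_mulVec {n m r : ℕ} (x : Fin n → ℝ) (α : ℝ) (A : Fin m → Fin n → ℝ)
    (U : Matrix (Fin n) (Fin r) ℝ) (h : Fin r → ℝ) :
    colDev x α A (U.mulVec h) = h ⬝ᵥ fun j => colDev x α A (matCol U j) := by
  have key : ∀ a : Fin n → ℝ, a ⬝ᵥ U.mulVec h = ∑ j, h j * (a ⬝ᵥ matCol U j) := fun a => by
    rw [dotProduct_mulVec, dotProduct]
    refine Finset.sum_congr rfl fun j _ => ?_
    rw [mul_comm]; rfl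
  simp only [colDev, key, Finset.sum_mul, Finset.mul_sum]
  rw [dotProduct]
  simp only [mul_sub, Finset.sum_sub_distrib, Finset.mul_sum]
  congr 1
  · rw [Finset.sum_comm]
    refine Finset.sum_congr rfl fun j _ => Finset.sum_congr rfl fun i _ => ?_
    ring
  · refine Finset.sum_congr rfl fun j _ => ?_
    ring

lemma lintegral_exp_colDev_le {n m : ℕ} (hm : 0 < m) (x v : Fin n → ℝ) {α : ℝ} (hα : 0 ≤ α)
    (θ : ℝ) :
    ∫⁻ A, ENNReal.ofReal (Real.exp (θ * colDev x α A v))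
        ∂Measure.pi (fun _ : Fin m => gaussianVec n)
      ≤ ENNReal.ofReal (Real.exp (α * θ ^ 2 / m * (v ⬝ᵥ v))) := by
  have hm' : (m : ℝ) ≠ 0 := by positivity
  set w : Fin n → ℝ := (θ / m) • v with hw
  have hmeas : Measurable fun a : Fin n → ℝ => ENNReal.ofReal (Real.exp
      ((a ⬝ᵥ w) * trunc α (a ⬝ᵥ x) - betaK (vnorm x) α * (x ⬝ᵥ w))) :=
    (Real.measurable_exp.comp ((((measurable_dotProduct_right w).mul
      ((measurable_trunc α).comp (measurable_dotProduct_right x)))).sub_const _)).ennreal_ofReal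
  have hprod : ∀ A : Fin m → Fin n → ℝ, ENNReal.ofReal (Real.exp (θ * colDev x α A v))
      = ∏ i, ENNReal.ofReal (Real.exp
        ((A i ⬝ᵥ w) * trunc α (A i ⬝ᵥ x) - betaK (vnorm x) α * (x ⬝ᵥ w))) := fun A => by
    rw [← ENNReal.ofReal_prod_of_nonneg fun _ _ => (Real.exp_pos _).le, ← Real.exp_sum]
    congr 2
    simp only [hw, dotProduct_smul, smul_eq_mul, Finset.sum_sub_distrib, Finset.sum_const,
      Finset.card_univ, Fintype.card_fin, nsmul_eq_mul, colDev, mul_assoc, ← Finset.mul_sum]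
    field_simp
  simp_rw [hprod]
  rw [lintegral_prod_pi (fun _ : Fin m => gaussianVec n) (fun _ a => ENNReal.ofReal (Real.exp
        ((a ⬝ᵥ w) * trunc α (a ⬝ᵥ x) - betaK (vnorm x) α * (x ⬝ᵥ w)))) (fun _ => hmeas),
    Finset.prod_const, Finset.card_univ, Fintype.card_fin]
  refine (pow_le_pow_left' (lintegral_exp_trunc_le w x hα) m).trans_eq ?_
  rw [← ENNReal.ofReal_pow (Real.exp_pos _).le, ← Real.exp_nat_mul]
  congr 2
  simp only [hw, dotProduct_smul, smul_dotProduct, smul_eq_mul]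
  field_simp

lemma mulVec_dotProduct_mulVec_of_orthonormal {n r : ℕ} {U : Matrix (Fin n) (Fin r) ℝ}
    (hU : Uᵀ * U = 1) (h : Fin r → ℝ) : U.mulVec h ⬝ᵥ U.mulVec h = h ⬝ᵥ h := by
  rw [dotProduct_mulVec, ← mulVec_transpose, mulVec_mulVec, hU, one_mulVec]

lemma lintegral_exp_sq_colDev_le {n m r : ℕ} (hm : 0 < m) (x : Fin n → ℝ) {α : ℝ} (hα : 0 < α)
    {U : Matrix (Fin n) (Fin r) ℝ} (hU : Uᵀ * U = 1) :
    ∫⁻ A, ENNReal.ofReal (Real.exp (m / (8 * α) * ∑ j, colDev x α A (matCol U j) ^ 2))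
        ∂Measure.pi (fun _ : Fin m => gaussianVec n) ≤ ENNReal.ofReal (√2) ^ r := by
  have hm' : (0 : ℝ) < m := by positivity
  set θ : ℝ := √(m / (4 * α)) with hθ
  have hθ2 : θ ^ 2 = m / (4 * α) := Real.sq_sqrt (by positivity)
  have hlin : ∀ A : Fin m → Fin n → ℝ,
      ENNReal.ofReal (Real.exp (m / (8 * α) * ∑ j, colDev x α A (matCol U j) ^ 2))
      = ∫⁻ h, ENNReal.ofReal (Real.exp (θ * colDev x α A (U.mulVec h))) ∂gaussianVec r :=
    fun A => by
    have h := lintegral_exp_dotProduct (θ • fun j => colDev x α A (matCol U j))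
    simp only [dotProduct_smul, smul_dotProduct, smul_eq_mul, ← colDev_mulVec] at h
    rw [h]
    congr 2
    rw [colDev_mulVec, ← mul_assoc, ← sq, hθ2]
    simp only [dotProduct, ← sq]
    ring
  simp_rw [hlin]
  rw [lintegral_lintegral_swap]
  · calc _ ≤ ∫⁻ h, ENNReal.ofReal (Real.exp (h ⬝ᵥ h / 4)) ∂gaussianVec r := by
          refine lintegral_mono fun h => (lintegral_exp_colDev_le hm x _ hα.le θ).trans_eq ?_
          rw [mulVec_dotProduct_mulVec_of_orthonormal hU, hθ2]
          congr 2
          field_simp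
      _ = _ := lintegral_exp_dotProduct_self_div_four r
  · refine Measurable.aemeasurable ?_
    simp only [Function.uncurry_def, colDev_mulVec, dotProduct]
    refine (Real.measurable_exp.comp (measurable_const.mul
      (Finset.measurable_fun_sum _ fun j _ => ?_))).ennreal_ofReal
    exact ((measurable_pi_apply j).comp measurable_snd).mul
      ((measurable_colDev x α _).comp measurable_fst)

lemma lintegral_exp_sum_sq_colDev_le {n m q r : ℕ} (hm : 0 < m) (x : Fin q → Fin n → ℝ) {α : ℝ}
    (hα : 0 < α) {U : Matrix (Fin n) (Fin r) ℝ} (hU : Uᵀ * U = 1) :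
    ∫⁻ ω, ENNReal.ofReal (Real.exp
        (m / (8 * α) * ∑ k, ∑ j, colDev (x k) α (ω k) (matCol U j) ^ 2)) ∂gaussianMatrices q m n
      ≤ ENNReal.ofReal (Real.exp ((q : ℝ) * r)) := by
  have hprod : ∀ ω : Fin q → Fin m → Fin n → ℝ, ENNReal.ofReal (Real.exp
        (m / (8 * α) * ∑ k, ∑ j, colDev (x k) α (ω k) (matCol U j) ^ 2))
      = ∏ k, ENNReal.ofReal (Real.exp
        (m / (8 * α) * ∑ j, colDev (x k) α (ω k) (matCol U j) ^ 2)) := fun ω => by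
    rw [← ENNReal.ofReal_prod_of_nonneg fun _ _ => (Real.exp_pos _).le, ← Real.exp_sum,
      Finset.mul_sum]
  simp_rw [hprod]
  rw [gaussianMatrices, lintegral_prod_pi (fun _ : Fin q => Measure.pi fun _ : Fin m => gaussianVec n)
    (fun k A => ENNReal.ofReal (Real.exp
        (m / (8 * α) * ∑ j, colDev (x k) α A (matCol U j) ^ 2)))
    (fun k => (Real.measurable_exp.comp (measurable_const.mul (Finset.measurable_fun_sum _
      fun j _ => (measurable_colDev (x k) α _).pow_const 2))).ennreal_ofReal)]
  refine (Finset.prod_le_prod' fun k _ => lintegral_exp_sq_colDev_le hm (x k) hα hU).trans ?_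
  rw [Finset.prod_const, Finset.card_univ, Fintype.card_fin, ← pow_mul,
    ← ENNReal.ofReal_pow (Real.sqrt_nonneg 2)]
  refine ENNReal.ofReal_le_ofReal ?_
  have h2 : √2 ≤ Real.exp 1 := by
    have h1 : √2 ≤ 2 := by rw [Real.sqrt_le_left (by norm_num)]; norm_num
    linarith [Real.add_one_le_exp (1 : ℝ)]
  calc √2 ^ (r * q) ≤ Real.exp 1 ^ (r * q) := pow_le_pow_left₀ (Real.sqrt_nonneg 2) h2 _
    _ = Real.exp ((q : ℝ) * r) := by rw [← Real.exp_nat_mul]; push_cast; ring_nf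

lemma initMat_sub_transpose_mul_apply {n q m r : ℕ} (X : Matrix (Fin n) (Fin q) ℝ) (α : ℝ)
    (ω : Fin q → Fin m → Fin n → ℝ) (U : Matrix (Fin n) (Fin r) ℝ) (k : Fin q) (j : Fin r) :
    ((initMat (fun k => matCol X k) α ω -
      X * Matrix.diagonal (fun k => betaK (vnorm (matCol X k)) α))ᵀ * U) k j
      = colDev (matCol X k) α (ω k) (matCol U j) := by
  rw [Matrix.mul_apply, colDev]
  simp only [transpose_apply, Matrix.sub_apply, mul_diagonal, initMat, of_apply, sub_mul,
    Finset.sum_sub_distrib]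
  congr 1
  · simp only [Finset.mul_sum, Finset.sum_mul]
    rw [Finset.sum_comm]
    refine Finset.sum_congr rfl fun i _ => ?_
    have hdot : ω k i ⬝ᵥ matCol U j = ∑ l, ω k i l * U l j := rfl
    rw [hdot, Finset.sum_mul, Finset.mul_sum]
    refine Finset.sum_congr rfl fun l _ => ?_
    simp only [trunc]; ring
  · rw [dotProduct, Finset.mul_sum]
    refine Finset.sum_congr rfl fun l _ => ?_
    simp only [matCol]; ring

lemma colDev_zero_threshold {n m : ℕ} (x : Fin n → ℝ) (A : Fin m → Fin n → ℝ)
    (v : Fin n → ℝ) : colDev x 0 A v = 0 := by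
  have ht : ∀ t : ℝ, trunc 0 t = 0 := fun t => by simpa using abs_trunc_le (α := 0) t
  by_cases hx : x = 0
  · simp [colDev, ht, hx]
  have hn : vnorm x ≠ 0 := fun h => hx <| by
    have := vnorm_sq x
    rwa [h, zero_pow two_ne_zero, eq_comm, dotProduct_self_eq_zero] at this
  have hb : betaK (vnorm x) 0 = 0 := by
    rw [betaK, ← integral_zero ℝ ℝ]
    refine integral_congr_ae (ae_of_all _ fun z => ?_)
    have := ht (vnorm x * z)
    simp only [trunc, mul_pow, mul_eq_zero, hn, false_or] at this
    rcases this with h | h <;> simp [h]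
  simp [colDev, ht, hb]

lemma frob_sq {ι ι' : Type*} [Fintype ι] [Fintype ι'] (M : Matrix ι ι' ℝ) :
    frob M ^ 2 = ∑ i, ∑ j, M i j ^ 2 :=
  Real.sq_sqrt (Finset.sum_nonneg fun _ _ => Finset.sum_nonneg fun _ _ => sq_nonneg _)

lemma frob_nonneg {ι ι' : Type*} [Fintype ι] [Fintype ι'] (M : Matrix ι ι' ℝ) : 0 ≤ frob M :=
  Real.sqrt_nonneg _

/-- Tail bound for the deviation of the left-projected truncated initialization. -/
lemma measure_frob_initMat_ge_le {n m q r : ℕ} (hm : 0 < m) (X : Matrix (Fin n) (Fin q) ℝ)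
    {α : ℝ} (hα : 0 < α) {U : Matrix (Fin n) (Fin r) ℝ} (hU : Uᵀ * U = 1) {t : ℝ} (ht : 0 ≤ t) :
    gaussianMatrices q m n {ω | frob ((initMat (fun k => matCol X k) α ω -
        X * Matrix.diagonal (fun k => betaK (vnorm (matCol X k)) α))ᵀ * U) ≤ t}ᶜ
      ≤ ENNReal.ofReal (Real.exp ((q : ℝ) * r - m * t ^ 2 / (8 * α))) := by
  set F : (Fin q → Fin m → Fin n → ℝ) → ℝ≥0∞ := fun ω => ENNReal.ofReal (Real.exp
    (m / (8 * α) * ∑ k, ∑ j, colDev (matCol X k) α (ω k) (matCol U j) ^ 2)) with hF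
  set ε : ℝ≥0∞ := ENNReal.ofReal (Real.exp (m * t ^ 2 / (8 * α))) with hε
  have hε0 : ε ≠ 0 := by simp [hε, Real.exp_pos]
  have hεt : ε ≠ ∞ := ENNReal.ofReal_ne_top
  have hFm : Measurable F :=
    (Real.measurable_exp.comp (measurable_const.mul (Finset.measurable_fun_sum _ fun k _ =>
      Finset.measurable_fun_sum _ fun j _ => ((measurable_colDev (matCol X k) α _).comp
        (measurable_pi_apply k)).pow_const 2))).ennreal_ofReal
  have hsub : {ω | frob ((initMat (fun k => matCol X k) α ω -
        X * Matrix.diagonal (fun k => betaK (vnorm (matCol X k)) α))ᵀ * U) ≤ t}ᶜ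
      ⊆ {ω | ε ≤ F ω} := fun ω hω => by
    simp only [Set.mem_compl_iff, Set.mem_ofPred_eq, not_le] at hω ⊢
    refine ENNReal.ofReal_le_ofReal (Real.exp_le_exp.2 ?_)
    have h2 := pow_le_pow_left₀ ht hω.le 2
    rw [frob_sq] at h2
    simp only [initMat_sub_transpose_mul_apply] at h2
    calc (m : ℝ) * t ^ 2 / (8 * α) = m / (8 * α) * t ^ 2 := by ring
      _ ≤ _ := mul_le_mul_of_nonneg_left h2 (by positivity)
  have hmarkov := (mul_meas_ge_le_lintegral (μ := gaussianMatrices q m n) hFm ε).trans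
    (lintegral_exp_sum_sq_colDev_le hm (fun k => matCol X k) hα hU)
  refine (measure_mono hsub).trans ?_
  rw [Real.exp_sub, ENNReal.ofReal_div_of_pos (Real.exp_pos _),
    ENNReal.le_div_iff_mul_le (Or.inl hε0) (Or.inl hεt), mul_comm]
  exact hmarkov

/-- **Lemma 3.8, part 2** (concentration of the left-projected truncated initialization,
fixed threshold). -/
theorem lemma38_part2 :
    ∃ c : ℝ, 0 < c ∧
    ∀ (n q r m : ℕ) (Ustar : Matrix (Fin n) (Fin r) ℝ) (Btil : Matrix (Fin r) (Fin q) ℝ)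
      (μ ε₁ σp σm κ α : ℝ),
      Ustarᵀ * Ustar = 1 → Btil.rank = r →
      σp = spec (Ustar * Btil) → σm = sigMin Btil → κ = σp / σm →
      1 ≤ μ → (∀ k, vnorm (matCol Btil k) ≤ μ * σp * Real.sqrt ((r : ℝ) / q)) →
      0 < ε₁ → ε₁ < 1 →
      9 * κ ^ 2 * μ ^ 2 * (1 - ε₁) * frob (Ustar * Btil) ^ 2 / q ≤ α →
      α ≤ 9 * κ ^ 2 * μ ^ 2 * (1 + ε₁) * frob (Ustar * Btil) ^ 2 / q →
      ENNReal.ofReal (1 - Real.exp ((q : ℝ) * r - c * ε₁ ^ 2 * m * q / (μ ^ 2 * κ ^ 2))) ≤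
        gaussianMatrices q m n {ω |
          frob ((initMat (fun k => matCol (Ustar * Btil) k) α ω -
              (Ustar * Btil) * Matrix.diagonal (fun k =>
                betaK (vnorm (matCol (Ustar * Btil) k)) α))ᵀ * Ustar) ≤
            1.1 * ε₁ * frob (Ustar * Btil)} := by
  refine ⟨1 / 144, by norm_num, ?_⟩
  intro n q r m U B μ ε σp σm κ α hU _ _ _ _ hμ _ hε0 hε1 hlo hup
  set X := U * B with hX
  have hF := frob_nonneg X
  have hε1' : 0 ≤ 1 - ε := by linarith
  have hα0 : 0 ≤ α := le_trans (by positivity) hlo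
  have ht : 0 ≤ 1.1 * ε * frob X := by positivity
  rcases hα0.eq_or_lt with rfl | hα
  · have hall : {ω : Fin q → Fin m → Fin n → ℝ | frob ((initMat (fun k => matCol X k) 0 ω -
        X * Matrix.diagonal (fun k => betaK (vnorm (matCol X k)) 0))ᵀ * U) ≤ 1.1 * ε * frob X}
        = Set.univ := Set.eq_univ_of_forall fun ω => by
      simp only [Set.mem_ofPred_eq]
      rw [frob]
      simp only [initMat_sub_transpose_mul_apply, colDev_zero_threshold]
      simpa using ht
    rw [hall, measure_univ]
    exact ENNReal.ofReal_le_one.2 (sub_le_self _ (Real.exp_pos _).le)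
  rcases Nat.eq_zero_or_pos m with rfl | hm
  · rw [ENNReal.ofReal_of_nonpos]
    · exact zero_le
    · have : (1 : ℝ) ≤ Real.exp ((q : ℝ) * r) := Real.one_le_exp (by positivity)
      simpa using this
  have hpos := hα.trans_le hup
  have hq : (0 : ℝ) < q := by
    refine lt_of_le_of_ne (by positivity) fun h => ?_
    simp [← h] at hpos
  have hκ : κ ≠ 0 := fun h => by simp [h] at hpos
  have hκ2 : 0 < κ ^ 2 := by positivity
  have hμ2 : 0 < μ ^ 2 := by positivity
  have hup' : α * q ≤ 18 * (κ ^ 2 * μ ^ 2 * frob X ^ 2) := by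
    rw [le_div_iff₀ hq] at hup
    have : 0 ≤ κ ^ 2 * μ ^ 2 * frob X ^ 2 := by positivity
    nlinarith
  have hexp : 1 / 144 * ε ^ 2 * m * q / (μ ^ 2 * κ ^ 2)
      ≤ m * (1.1 * ε * frob X) ^ 2 / (8 * α) := by
    rw [div_le_div_iff₀ (by positivity) (by positivity)]
    have h1 := mul_le_mul_of_nonneg_left hup' (show 0 ≤ 1 / 18 * ε ^ 2 * m by positivity)
    have h2 : 0 ≤ m * ε ^ 2 * (κ ^ 2 * μ ^ 2 * frob X ^ 2) := by positivity
    nlinarith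
  have htail := measure_frob_initMat_ge_le hm X hα hU ht
  have hone := measure_univ_le_add_compl (μ := gaussianMatrices q m n)
    {ω | frob ((initMat (fun k => matCol X k) α ω -
        X * Matrix.diagonal (fun k => betaK (vnorm (matCol X k)) α))ᵀ * U) ≤ 1.1 * ε * frob X}
  rw [measure_univ] at hone
  rw [ENNReal.ofReal_sub _ (Real.exp_pos _).le, ENNReal.ofReal_one]
  refine tsub_le_iff_right.2 (hone.trans (add_le_add_right (htail.trans ?_) _))
  exact ENNReal.ofReal_le_ofReal (Real.exp_le_exp.2 (by linarith))
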